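/- Let H be an elementary abelian 2-hypergroup and G a closed subset of H. Then G^{(r)} = O^ϑ(G) for every r ∈ ℕ with r ≥ 2. Moreover, G is a nilpotent closed subset of H if and only if G = O_ϑ(G). In particular, H is a nilpotent hypergroup if and only if H = O_ϑ(H). -/

import Mathlib

namespace HyperPaper

/-- A hypergroup: hypermultiplication `hmul`, inversion `star`, identity `e`,
satisfying (H1) associativity, (H2) unique two-sided identity, (H3) exchange conditions. -/
structure Hypergroup (H : Type*) where
  hmul : H → H → Set H
  star : H → H
  e : H
  idl : ∀ p, hmul e p = {p}
  idr : ∀ p, hmul p e = {p}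
  e_unique : ∀ e' : H, (∀ p, hmul e' p = {p} ∧ hmul p e' = {p}) → e' = e
  assoc : ∀ p q r : H, (⋃ x ∈ hmul p q, hmul x r) = ⋃ x ∈ hmul q r, hmul p x
  h3l : ∀ p q r : H, p ∈ hmul q r ↔ q ∈ hmul p (star r)
  h3r : ∀ p q r : H, p ∈ hmul q r ↔ r ∈ hmul (star q) p

variable {H : Type*}

namespace Hypergroup

/-- Product of two subsets: FG = {a : ∃ b ∈ F, c ∈ G, a ∈ bc}. -/
def smul (hg : Hypergroup H) (F G : Set H) : Set H :=
  {a | ∃ b ∈ F, ∃ c ∈ G, a ∈ hg.hmul b c}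

/-- Closed subset: nonempty and G*G ⊆ G. -/
def IsClosed (hg : Hypergroup H) (G : Set H) : Prop :=
  G.Nonempty ∧ hg.smul (hg.star '' G) G ⊆ G

/-- Thin element: p*p = {e}. -/
def IsThin (hg : Hypergroup H) (p : H) : Prop := hg.hmul (hg.star p) p = {hg.e}

/-- Thick element: not thin. -/
def IsThick (hg : Hypergroup H) (p : H) : Prop := ¬ hg.IsThin p

/-- Involution: p ≠ e and {e, p} is closed. -/
def IsInvolution (hg : Hypergroup H) (p : H) : Prop :=
  p ≠ hg.e ∧ hg.IsClosed {hg.e, p}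

/-- ⟨G⟩: smallest closed subset containing G. -/
def gen (hg : Hypergroup H) (G : Set H) : Set H := ⋂₀ {C | hg.IsClosed C ∧ G ⊆ C}

/-- O_ϑ(G): the thin elements of H lying in G. -/
def Othin (hg : Hypergroup H) (G : Set H) : Set H := {p ∈ G | hg.IsThin p}

/-- F is a strongly normal closed subset of G: p*Fp ⊆ F ⊆ G for all p ∈ G. -/
def IsStronglyNormal (hg : Hypergroup H) (F G : Set H) : Prop :=
  hg.IsClosed F ∧ hg.IsClosed G ∧ F ⊆ G ∧
    ∀ p ∈ G, hg.smul (hg.smul {hg.star p} F) {p} ⊆ F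

/-- O^ϑ(G): intersection of all strongly normal closed subsets of ⟨G⟩. -/
def Osup (hg : Hypergroup H) (G : Set H) : Set H :=
  ⋂₀ {F | hg.IsStronglyNormal F (hg.gen G)}

/-- F is a normal closed subset of G. -/
def IsNormal (hg : Hypergroup H) (F G : Set H) : Prop :=
  hg.IsClosed F ∧ hg.IsClosed G ∧ F ⊆ G ∧ ∀ p ∈ G, hg.smul F {p} = hg.smul {p} F

/-- Product of a list of subsets (empty product is {e}). -/
def listProd (hg : Hypergroup H) : List (Set H) → Set H
  | [] => {hg.e}
  | a :: l => hg.smul a (hg.listProd l)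

/-- Product r_1 r_2 ⋯ r_n of a family of elements. -/
def famProd (hg : Hypergroup H) {n : ℕ} (r : Fin n → H) : Set H :=
  hg.listProd ((List.finRange n).map fun i => ({r i} : Set H))

/-- Ĝ_i: the product of the G_j with j ≠ i. -/
def cofactor (hg : Hypergroup H) {n : ℕ} (G : Fin n → Set H) (i : Fin n) : Set H :=
  hg.listProd (((List.finRange n).filter fun j => decide (j ≠ i)).map G)

/-- H is the direct product of the normal closed subsets G_1, …, G_n. -/
def IsDirectProduct (hg : Hypergroup H) {n : ℕ} (G : Fin n → Set H) : Prop :=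
  (∀ i, hg.IsNormal (G i) Set.univ) ∧
  (∀ i, hg.smul (G i) (hg.cofactor G i) = Set.univ) ∧
  (∀ i, G i ∩ hg.cofactor G i = {hg.e})

/-- r : Fin n → H is a decomposition of x with respect to the family G. -/
def IsDecomp (hg : Hypergroup H) {n : ℕ} (G : Fin n → Set H) (x : H) (r : Fin n → H) : Prop :=
  (∀ i, r i ∈ G i) ∧ x ∈ hg.famProd r

/-- The support of x: the elements ≠ e appearing in the decomposition of x. -/
def dsupport (hg : Hypergroup H) {n : ℕ} (G : Fin n → Set H) (x : H) : Set H :=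
  {y | y ≠ hg.e ∧ ∃ r, hg.IsDecomp G x r ∧ y ∈ Set.range r}

/-- The cover of x: the product r_1r_2⋯r_n for the decomposition of x. -/
def dcover (hg : Hypergroup H) {n : ℕ} (G : Fin n → Set H) (x : H) : Set H :=
  {y | ∃ r, hg.IsDecomp G x r ∧ y ∈ hg.famProd r}

/-- x is constrained: its cover equals {x}. -/
def IsConstrained (hg : Hypergroup H) {n : ℕ} (G : Fin n → Set H) (x : H) : Prop :=
  hg.dcover G x = {x}

/-- r_2(G): the largest 2-rank of a thin closed subset of H contained in G
(equivalently, the largest k such that G contains a thin symmetric closed subset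
of 2^k elements, which corresponds to an elementary abelian 2-group of 2-rank k). -/
noncomputable def rank2 (hg : Hypergroup H) (G : Set H) : ℕ :=
  sSup {k | ∃ U : Set H, hg.IsClosed U ∧ U ⊆ G ∧ (∀ u ∈ U, hg.IsThin u) ∧
    (∀ u ∈ U, hg.star u = u) ∧ U.ncard = 2 ^ k}

/-- F is a minimal generating subset of G. -/
def IsMinGen (hg : Hypergroup H) (G F : Set H) : Prop :=
  F ⊆ G ∧ hg.gen F = G ∧ ∀ p ∈ F, hg.gen (F \ {p}) ≠ G

/-- The dimension of G: the smallest cardinality of a minimal generating subset. -/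
noncomputable def dimension (hg : Hypergroup H) (G : Set H) : ℕ :=
  sInf {k | ∃ F : Set H, hg.IsMinGen G F ∧ F.Finite ∧ F.ncard = k}

/-- [F, G] = ⟨{a : ∃ b ∈ F, c ∈ G, a ∈ b*c*bc}⟩. -/
def commSet (hg : Hypergroup H) (F G : Set H) : Set H :=
  hg.gen {a | ∃ b ∈ F, ∃ c ∈ G,
    a ∈ hg.smul (hg.smul (hg.smul {hg.star b} {hg.star c}) {b}) {c}}

/-- derived G k = G^{(k+1)}: G^{(1)} = G, G^{(r)} = [G^{(r-1)}, G]. -/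
def derived (hg : Hypergroup H) (G : Set H) : ℕ → Set H
  | 0 => G
  | k + 1 => hg.commSet (hg.derived G k) G

/-- G is nilpotent: G^{(r)} = {e} for some r. -/
def IsNilpotent (hg : Hypergroup H) (G : Set H) : Prop :=
  ∃ k : ℕ, hg.derived G k = {hg.e}

/-- G is a residually thin closed subset: there is a chain {e} = F_1, …, F_n = G of
pairwise distinct closed subsets, each strongly normal in the next. -/
def IsResiduallyThin (hg : Hypergroup H) (G : Set H) : Prop :=
  ∃ (m : ℕ) (F : Fin (m + 1) → Set H), Function.Injective F ∧
    F 0 = {hg.e} ∧ F (Fin.last m) = G ∧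
    ∀ i : Fin m, hg.IsStronglyNormal (F i.castSucc) (F i.succ)

/-- x^k as a subset: x^0 = {e}, x^{k+1} = x^k · x. -/
def spow (hg : Hypergroup H) (x : H) : ℕ → Set H
  | 0 => {hg.e}
  | k + 1 => hg.smul (hg.spow x k) {x}

/-- F is a maximal closed subset of G. -/
def IsMaximalClosed (hg : Hypergroup H) (F G : Set H) : Prop :=
  hg.IsClosed F ∧ hg.IsClosed G ∧ F ⊆ G ∧ F ≠ G ∧
    ∀ E : Set H, hg.IsClosed E → F ⊆ E → E ⊆ G → E = F ∨ E = G

/-- The Frattini closed subset of G: the intersection (inside G) of all maximal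
closed subsets of G. -/
def frattini (hg : Hypergroup H) (G : Set H) : Set H :=
  G ∩ ⋂₀ {F | hg.IsMaximalClosed F G}

/-- α is an isomorphism from the closed subset F to the closed subset G. -/
def IsIso (hg : Hypergroup H) (F G : Set H) (α : H → H) : Prop :=
  Set.BijOn α F G ∧ α hg.e = hg.e ∧
    ∀ p ∈ F, ∀ q ∈ F, α '' hg.hmul p q = hg.hmul (α p) (α q)

/-- F ≃ G: there is an isomorphism from F to G. -/
def Isomorphic (hg : Hypergroup H) (F G : Set H) : Prop := ∃ α : H → H, hg.IsIso F G α

/-- Aut(G): the automorphism group of G, realized as the subgroup of permutations of G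
that fix e and preserve the hypermultiplication. -/
def autGroup (hg : Hypergroup H) (G : Set H) : Subgroup (Equiv.Perm G) where
  carrier := {σ | (∀ x : G, (x : H) = hg.e → ((σ x : H)) = hg.e) ∧
    ∀ p q x : G, (x : H) ∈ hg.hmul p q ↔ ((σ x : H)) ∈ hg.hmul (σ p) (σ q)}
  one_mem' := by
    constructor
    · intro x hx; simpa using hx
    · intro p q x; simp
  mul_mem' := by
    rintro σ τ ⟨he1, hm1⟩ ⟨he2, hm2⟩
    refine ⟨fun x hx => ?_, fun p q x => ?_⟩
    · simpa using he1 _ (he2 x hx)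
    · simpa using (hm2 p q x).trans (hm1 (τ p) (τ q) (τ x))
  inv_mem' := by
    rintro σ ⟨he, hm⟩
    refine ⟨fun x hx => ?_, fun p q x => ?_⟩
    · have h2 : σ x = x := Subtype.ext ((he x hx).trans hx.symm)
      have h3 : σ⁻¹ x = x := by
        conv_lhs => rw [← h2]
        simp
      rw [h3]; exact hx
    · have h := hm (σ⁻¹ p) (σ⁻¹ q) (σ⁻¹ x)
      simpa using h.symm

end Hypergroup

/-- An elementary abelian 2-hypergroup: a hypergroup that is the constrained direct
product of the closed subsets ⟨q_1⟩, …, ⟨q_n⟩ generated by involutions q_1, …, q_n. -/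
structure EA2Data (H : Type*) where
  hg : Hypergroup H
  n : ℕ
  q : Fin n → H
  invol : ∀ i, hg.IsInvolution (q i)
  dp : hg.IsDirectProduct fun i => hg.gen {q i}
  constrained : ∀ x : H, hg.IsConstrained (fun i => hg.gen {q i}) x

namespace EA2Data

/-- The family ⟨q_1⟩, …, ⟨q_n⟩. -/
def fam (E : EA2Data H) : Fin E.n → Set H := fun i => E.hg.gen {E.q i}

/-- The support of x. -/
def support (E : EA2Data H) (x : H) : Set H := E.hg.dsupport E.fam x

/-- Thick(F): externally thick elements of H lying in F. -/
def ThickIn (E : EA2Data H) (F : Set H) : Set H :=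
  {x ∈ F | x = E.hg.e ∨ ∀ y ∈ E.support x, E.hg.IsThick y}

/-- Thin(F): externally thin elements of H lying in F. -/
def ThinIn (E : EA2Data H) (F : Set H) : Set H :=
  {x ∈ F | x = E.hg.e ∨ ∀ y ∈ E.support x, E.hg.IsThin y}

/-- The (unique) pair (x⁺, x⁻) with x⁺ ∈ Thick(H), x⁻ ∈ Thin(H), x⁺x⁻ = {x}. -/
noncomputable def pm (E : EA2Data H) (x : H) : H × H :=
  @Classical.epsilon (H × H) ⟨(E.hg.e, E.hg.e)⟩ fun z =>
    z.1 ∈ E.ThickIn Set.univ ∧ z.2 ∈ E.ThinIn Set.univ ∧ E.hg.hmul z.1 z.2 = {x}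

/-- x⁺. -/
noncomputable def plus (E : EA2Data H) (x : H) : H := (E.pm x).1

/-- x⁻. -/
noncomputable def minus (E : EA2Data H) (x : H) : H := (E.pm x).2

/-- s(x): the number of thick elements of H in the support of x. -/
noncomputable def sElem (E : EA2Data H) (x : H) : ℕ :=
  {y ∈ E.support x | E.hg.IsThick y}.ncard

/-- s(G) = max {s(a) : a ∈ G}. -/
noncomputable def sSet (E : EA2Data H) (G : Set H) : ℕ :=
  sSup {k | ∃ a ∈ G, E.sElem a = k}

/-- x ⪯ y: the support of x is contained in the support of y. -/
def ple (E : EA2Data H) (x y : H) : Prop := E.support x ⊆ E.support y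

/-- p♯: the number of thick elements among q_1, …, q_n. -/
noncomputable def psharp (E : EA2Data H) : ℕ := {i : Fin E.n | E.hg.IsThick (E.q i)}.ncard

end EA2Data

/-- The Gaussian binomial coefficient C(n, k)_2 with base 2, via the
q-Pascal recurrence C(n, k)_2 = C(n-1, k-1)_2 + 2^k · C(n-1, k)_2. -/
def gaussBinom2 : ℕ → ℕ → ℕ
  | _, 0 => 1
  | 0, _ + 1 => 0
  | n + 1, k + 1 => gaussBinom2 n k + 2 ^ (k + 1) * gaussBinom2 n (k + 1)

end HyperPaper

open HyperPaper

namespace HyperPaper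

namespace Hypergroup

variable {H : Type*} (hg : Hypergroup H)

theorem smul_singleton (a b : H) : hg.smul {a} {b} = hg.hmul a b := by
  ext x; simp [smul]

theorem e_smul (F : Set H) : hg.smul {hg.e} F = F := by
  ext x; simp [smul, hg.idl]

theorem smul_e (F : Set H) : hg.smul F {hg.e} = F := by
  ext x; simp [smul, hg.idr]

theorem smul_assoc (A B C : Set H) : hg.smul (hg.smul A B) C = hg.smul A (hg.smul B C) := by
  ext x
  constructor
  · rintro ⟨y, ⟨a, ha, b, hb, hy⟩, c, hc, hx⟩
    have h : x ∈ ⋃ z ∈ hg.hmul b c, hg.hmul a z := by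
      rw [← hg.assoc]
      simpa using ⟨y, hy, hx⟩
    obtain ⟨z, hz, hxz⟩ : ∃ z ∈ hg.hmul b c, x ∈ hg.hmul a z := by simpa using h
    exact ⟨a, ha, z, ⟨b, hb, c, hc, hz⟩, hxz⟩
  · rintro ⟨a, ha, z, ⟨b, hb, c, hc, hz⟩, hx⟩
    have h : x ∈ ⋃ y ∈ hg.hmul a b, hg.hmul y c := by
      rw [hg.assoc]
      simpa using ⟨z, hz, hx⟩
    obtain ⟨y, hy, hxy⟩ : ∃ y ∈ hg.hmul a b, x ∈ hg.hmul y c := by simpa using h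
    exact ⟨y, ⟨a, ha, b, hb, hy⟩, c, hc, hxy⟩

theorem e_mem_star_hmul_self (p : H) : hg.e ∈ hg.hmul (hg.star p) p := by
  rw [← hg.h3r, hg.idr]; rfl

theorem star_star (p : H) : hg.star (hg.star p) = p := by
  have h := (hg.h3r _ _ _).1 (hg.e_mem_star_hmul_self p)
  rw [hg.idr] at h
  exact h.symm

theorem star_e : hg.star hg.e = hg.e := by
  have h := hg.e_mem_star_hmul_self hg.e
  rw [hg.idr] at h
  exact h.symm

theorem isThin_e : hg.IsThin hg.e := by
  rw [IsThin, hg.star_e, hg.idl]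

variable {hg}

theorem IsClosed.e_mem {G : Set H} (h : hg.IsClosed G) : hg.e ∈ G := by
  obtain ⟨x, hx⟩ := h.1
  exact h.2 ⟨_, ⟨x, hx, rfl⟩, x, hx, hg.e_mem_star_hmul_self x⟩

theorem IsClosed.star_mem {G : Set H} (h : hg.IsClosed G) {x : H} (hx : x ∈ G) :
    hg.star x ∈ G :=
  h.2 ⟨_, ⟨x, hx, rfl⟩, hg.e, h.e_mem, by rw [hg.idr]; rfl⟩

theorem IsClosed.hmul_mem {G : Set H} (h : hg.IsClosed G) {a b x : H} (ha : a ∈ G) (hb : b ∈ G)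
    (hx : x ∈ hg.hmul a b) : x ∈ G :=
  h.2 ⟨a, ⟨hg.star a, h.star_mem ha, hg.star_star a⟩, b, hb, hx⟩

variable (hg)

theorem isClosed_univ : hg.IsClosed Set.univ := ⟨⟨hg.e, trivial⟩, Set.subset_univ _⟩

theorem isClosed_singleton_e : hg.IsClosed {hg.e} := by
  refine ⟨⟨hg.e, rfl⟩, ?_⟩
  rw [Set.image_singleton, hg.star_e, hg.e_smul]

theorem isClosed_gen (A : Set H) : hg.IsClosed (hg.gen A) := by
  refine ⟨⟨hg.e, fun C hC => hC.1.e_mem⟩, ?_⟩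
  rintro x ⟨_, ⟨a, ha, rfl⟩, b, hb, hx⟩ C hC
  exact hC.1.2 ⟨_, ⟨a, ha C hC, rfl⟩, b, hb C hC, hx⟩

theorem subset_gen (A : Set H) : A ⊆ hg.gen A := fun _ hx _ hC => hC.2 hx

variable {hg}

theorem gen_subset {A C : Set H} (hC : hg.IsClosed C) (h : A ⊆ C) : hg.gen A ⊆ C :=
  Set.sInter_subset_of_mem ⟨hC, h⟩

theorem IsClosed.gen_eq {G : Set H} (h : hg.IsClosed G) : hg.gen G = G :=
  (gen_subset h subset_rfl).antisymm (hg.subset_gen G)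

theorem subset_listProd {L : List (Set H)} (hL : ∀ A ∈ L, hg.e ∈ A) {A : Set H} (hA : A ∈ L) :
    A ⊆ hg.listProd L := by
  have he : ∀ L : List (Set H), (∀ A ∈ L, hg.e ∈ A) → hg.e ∈ hg.listProd L := by
    intro L
    induction L with
    | nil => intro _; rfl
    | cons B L ih =>
      intro h
      exact ⟨hg.e, h B (by simp), hg.e, ih fun A hA => h A (by simp [hA]), by rw [hg.idl]; rfl⟩
  induction L with
  | nil => simp at hA
  | cons B L ih =>
    intro x hx
    have hL' : ∀ A ∈ L, hg.e ∈ A := fun A hA => hL A (by simp [hA])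
    rcases List.mem_cons.1 hA with rfl | hA
    · exact ⟨x, hx, hg.e, he L hL', by rw [hg.idr]; rfl⟩
    · exact ⟨hg.e, hL B (by simp), x, ih hL' hA hx, by rw [hg.idl]; rfl⟩

theorem listProd_smul_comm {L : List (Set H)} {X : Set H}
    (h : ∀ A ∈ L, hg.smul A X = hg.smul X A) :
    hg.smul (hg.listProd L) X = hg.smul X (hg.listProd L) := by
  induction L with
  | nil => rw [listProd, hg.e_smul, hg.smul_e]
  | cons B L ih =>
    rw [listProd, hg.smul_assoc, ih fun A hA => h A (by simp [hA]), ← hg.smul_assoc,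
      h B (by simp), hg.smul_assoc]

/-- The set generating the thin residue: the union of the products `p*p` for `p ∈ G`. -/
def starProducts (hg : Hypergroup H) (G : Set H) : Set H :=
  {a | ∃ p ∈ G, a ∈ hg.hmul (hg.star p) p}

theorem IsClosed.gen_starProducts_subset {G : Set H} (hG : hg.IsClosed G) :
    hg.gen (hg.starProducts G) ⊆ G := by
  refine gen_subset hG ?_
  rintro a ⟨p, hp, ha⟩
  exact hG.hmul_mem (hG.star_mem hp) hp ha

theorem smul_comm_of_hmul_comm (hc : ∀ a b, hg.hmul a b = hg.hmul b a) (A B : Set H) :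
    hg.smul A B = hg.smul B A := by
  ext x
  constructor
  · rintro ⟨a, ha, b, hb, hx⟩
    exact ⟨b, hb, a, ha, hc a b ▸ hx⟩
  · rintro ⟨a, ha, b, hb, hx⟩
    exact ⟨b, hb, a, ha, hc a b ▸ hx⟩

theorem osup_eq_gen_starProducts (hc : ∀ a b, hg.hmul a b = hg.hmul b a) {G : Set H}
    (hG : hg.IsClosed G) : hg.Osup G = hg.gen (hg.starProducts G) := by
  apply Set.Subset.antisymm
  · refine Set.sInter_subset_of_mem ?_
    rw [Set.mem_ofPred_eq, hG.gen_eq]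
    refine ⟨hg.isClosed_gen _, hG, hG.gen_starProducts_subset, fun p hp => ?_⟩
    rw [smul_comm_of_hmul_comm hc {hg.star p}, hg.smul_assoc, hg.smul_singleton]
    rintro x ⟨a, ha, b, hb, hx⟩
    exact (hg.isClosed_gen _).hmul_mem ha (hg.subset_gen _ ⟨p, hp, hb⟩) hx
  · refine Set.subset_sInter fun F hF => gen_subset hF.1 ?_
    rintro a ⟨p, hp, ha⟩
    refine hF.2.2.2 p (hg.subset_gen G hp) ⟨hg.star p, ?_, p, rfl, ha⟩
    exact ⟨_, rfl, hg.e, hF.1.e_mem, by rw [hg.idr]; rfl⟩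

theorem commSet_eq_gen_starProducts (hc : ∀ a b, hg.hmul a b = hg.hmul b a) {F G : Set H}
    (he : hg.e ∈ F) (hFG : F ⊆ G) : hg.commSet F G = hg.gen (hg.starProducts G) := by
  apply Set.Subset.antisymm
  · refine gen_subset (hg.isClosed_gen _) ?_
    rintro a ⟨b, hb, c, hc', ha⟩
    rw [hg.smul_assoc {hg.star b}, smul_comm_of_hmul_comm hc {hg.star c}, ← hg.smul_assoc,
      hg.smul_assoc, hg.smul_singleton, hg.smul_singleton] at ha
    obtain ⟨u, hu, v, hv, hx⟩ := ha
    exact (hg.isClosed_gen _).hmul_mem (hg.subset_gen _ ⟨b, hFG hb, hu⟩)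
      (hg.subset_gen _ ⟨c, hc', hv⟩) hx
  · refine gen_subset (hg.isClosed_gen _) ?_
    rintro a ⟨p, hp, ha⟩
    refine hg.subset_gen _ ⟨hg.e, he, p, hp, ?_⟩
    rwa [hg.star_e, hg.e_smul, hg.smul_e, hg.smul_singleton]

theorem derived_succ_eq_gen_starProducts (hc : ∀ a b, hg.hmul a b = hg.hmul b a) {G : Set H}
    (hG : hg.IsClosed G) (k : ℕ) : hg.derived G (k + 1) = hg.gen (hg.starProducts G) := by
  induction k with
  | zero => exact commSet_eq_gen_starProducts hc hG.e_mem subset_rfl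
  | succ k ih =>
    rw [derived, ih]
    exact commSet_eq_gen_starProducts hc (hg.isClosed_gen _).e_mem hG.gen_starProducts_subset

theorem isNilpotent_iff_eq_othin (hc : ∀ a b, hg.hmul a b = hg.hmul b a) {G : Set H}
    (hG : hg.IsClosed G) : hg.IsNilpotent G ↔ G = hg.Othin G := by
  constructor
  · rintro ⟨k, hk⟩
    refine Set.Subset.antisymm (fun p hp => ⟨hp, ?_⟩) fun p hp => hp.1
    cases k with
    | zero =>
      have hpe : p ∈ ({hg.e} : Set H) := hk ▸ hp
      rw [Set.mem_singleton_iff.1 hpe]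
      exact hg.isThin_e
    | succ k =>
      rw [derived_succ_eq_gen_starProducts hc hG] at hk
      refine Set.Subset.antisymm (fun a ha => hk ▸ hg.subset_gen _ ⟨p, hp, ha⟩) ?_
      rintro _ rfl
      exact hg.e_mem_star_hmul_self p
  · intro h
    refine ⟨1, ?_⟩
    rw [derived_succ_eq_gen_starProducts hc hG]
    refine Set.Subset.antisymm (gen_subset hg.isClosed_singleton_e ?_) ?_
    · rintro a ⟨p, hp, ha⟩
      rw [h] at hp
      exact hp.2 ▸ ha
    · rintro _ rfl
      exact (hg.isClosed_gen _).e_mem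

end Hypergroup

namespace EA2Data

open Hypergroup

variable {H : Type*} (E : EA2Data H)

theorem gen_involution (i : Fin E.n) : E.hg.gen {E.q i} = {E.hg.e, E.q i} := by
  apply Set.Subset.antisymm
  · exact gen_subset (E.invol i).2 (by simp)
  · rintro x (rfl | rfl)
    · exact (E.hg.isClosed_gen _).e_mem
    · exact E.hg.subset_gen _ rfl

theorem involution_notMem_gen {i j : Fin E.n} (hij : i ≠ j) : E.q i ∉ E.hg.gen {E.q j} := by
  intro h
  have hmem : E.q i ∈ E.hg.gen {E.q i} ∩ E.hg.cofactor (fun i => E.hg.gen {E.q i}) i := by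
    refine ⟨E.hg.subset_gen _ rfl, subset_listProd ?_ (A := E.hg.gen {E.q j}) ?_ h⟩
    · intro A hA
      obtain ⟨k, -, rfl⟩ := List.mem_map.1 hA
      exact (E.hg.isClosed_gen _).e_mem
    · exact List.mem_map.2 ⟨j, by simpa using hij.symm, rfl⟩
  rw [E.dp.2.2 i] at hmem
  exact (E.invol i).1 hmem

theorem involution_hmul_subset {i j : Fin E.n} (hij : i ≠ j) :
    E.hg.hmul (E.q i) (E.q j) ⊆ E.hg.hmul (E.q j) (E.q i) := by
  intro a ha
  have hnorm : E.hg.smul (E.hg.gen {E.q i}) {E.q j} = E.hg.smul {E.q j} (E.hg.gen {E.q i}) :=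
    (E.dp.1 i).2.2.2 (E.q j) trivial
  have h : a ∈ E.hg.smul (E.hg.gen {E.q i}) {E.q j} :=
    ⟨_, E.hg.subset_gen _ rfl, _, rfl, ha⟩
  rw [hnorm, E.gen_involution] at h
  obtain ⟨_, rfl, c, rfl | rfl, hac⟩ := h
  · rw [E.hg.idr] at hac
    obtain rfl := hac
    have hcl := E.hg.isClosed_gen {E.q j}
    have hj : E.q j ∈ E.hg.gen {E.q j} := E.hg.subset_gen _ rfl
    exact absurd (hcl.hmul_mem hj (hcl.star_mem hj) ((E.hg.h3l _ _ _).1 ha))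
      (E.involution_notMem_gen hij)
  · exact hac

theorem hmul_comm_of_mem_gen {i j : Fin E.n} {a b : H} (ha : a ∈ E.hg.gen {E.q i})
    (hb : b ∈ E.hg.gen {E.q j}) : E.hg.hmul a b = E.hg.hmul b a := by
  rw [gen_involution] at ha hb
  obtain rfl | rfl := ha
  · rw [E.hg.idl, E.hg.idr]
  obtain rfl | rfl := hb
  · rw [E.hg.idl, E.hg.idr]
  by_cases hij : i = j
  · rw [hij]
  · exact (E.involution_hmul_subset hij).antisymm (E.involution_hmul_subset (Ne.symm hij))

theorem exists_famProd_eq_singleton (x : H) :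
    ∃ r : Fin E.n → H, (∀ i, r i ∈ E.hg.gen {E.q i}) ∧ E.hg.famProd r = {x} := by
  have hx := E.constrained x
  have hmem : x ∈ E.hg.dcover (fun i => E.hg.gen {E.q i}) x := by rw [hx]; rfl
  obtain ⟨r, hr, hxr⟩ := hmem
  refine ⟨r, hr.1, Set.Subset.antisymm (fun y hy => hx ▸ ⟨r, hr, hy⟩) ?_⟩
  rintro _ rfl
  exact hxr

theorem hmul_comm (a b : H) : E.hg.hmul a b = E.hg.hmul b a := by
  obtain ⟨r, hr, hra⟩ := E.exists_famProd_eq_singleton a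
  obtain ⟨s, hs, hsb⟩ := E.exists_famProd_eq_singleton b
  rw [← E.hg.smul_singleton, ← E.hg.smul_singleton, ← hra, ← hsb]
  refine listProd_smul_comm fun A hA => ?_
  obtain ⟨i, -, rfl⟩ := List.mem_map.1 hA
  refine (listProd_smul_comm fun B hB => ?_).symm
  obtain ⟨j, -, rfl⟩ := List.mem_map.1 hB
  rw [E.hg.smul_singleton, E.hg.smul_singleton]
  exact E.hmul_comm_of_mem_gen (hs j) (hr i)

end EA2Data

end HyperPaper

/-- For a closed subset G of an elementary abelian 2-hypergroup H:
G^{(r)} = O^ϑ(G) for all r ≥ 2 (here `derived G k` denotes G^{(k+1)}); G is nilpotent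
iff G = O_ϑ(G); in particular H is nilpotent iff H = O_ϑ(H). -/
theorem stmt14 {H : Type*} (E : EA2Data H) (G : Set H) (hG : E.hg.IsClosed G) :
    (∀ r : ℕ, 2 ≤ r → E.hg.derived G (r - 1) = E.hg.Osup G) ∧
    (E.hg.IsNilpotent G ↔ G = E.hg.Othin G) ∧
    (E.hg.IsNilpotent (Set.univ : Set H) ↔
      (Set.univ : Set H) = E.hg.Othin Set.univ) := by
  have hc := E.hmul_comm
  refine ⟨fun r hr => ?_, Hypergroup.isNilpotent_iff_eq_othin hc hG,
    Hypergroup.isNilpotent_iff_eq_othin hc E.hg.isClosed_univ⟩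
  obtain ⟨k, rfl⟩ := Nat.exists_eq_add_of_le' hr
  rw [Hypergroup.osup_eq_gen_starProducts hc hG]
  exact Hypergroup.derived_succ_eq_gen_starProducts hc hG k
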